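/- Let p be a type with denominator n on the alphabet X = {1,…,k}, let R > 0, and let C ⊆ T_p be a set of M distinct sequences with the packing property: for every x ∈ C and every non-identical conditional type V for x with output alphabet X, |T_V(x) ∩ (C \ {x})| ≤ |T_V(x)| · e^{−n(H(p)−R)}. If M ≥ e^{nR−√n}, then for every pair of distinct sequences x, x' ∈ C, one has (1/(|S_x| · M)) · |{s ∈ S_x : s·x' ∈ C}| ≤ e^{−n H(p)} e^{√n}, where S_x := {s ∈ S_n : s·x = x} is the stabilizer of x in the symmetric group S_n acting on X^n by permuting coordinates, (s·x)_j := x_{s^{-1}(j)}. -/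

import Mathlib

/-- The empirical distribution (type) of a word `x ∈ Xⁿ`. -/
noncomputable def typeOf {X : Type*} [Fintype X] [DecidableEq X] {n : ℕ}
    (x : Fin n → X) : X → ℝ :=
  fun a => ((Finset.univ.filter fun j => x j = a).card : ℝ) / n

/-- The joint empirical distribution of the pair sequence `((x₁,y₁),…,(xₙ,yₙ))`. -/
noncomputable def jointType {X Y : Type*} [Fintype X] [DecidableEq X]
    [Fintype Y] [DecidableEq Y] {n : ℕ} (x : Fin n → X) (y : Fin n → Y) :
    X × Y → ℝ :=
  fun a => ((Finset.univ.filter fun j => x j = a.1 ∧ y j = a.2).card : ℝ) / n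

/-- Shannon entropy `H(p) = -∑ p_i log p_i` (with `0 log 0 = 0`). -/
noncomputable def shannonH {X : Type*} [Fintype X] (p : X → ℝ) : ℝ :=
  -∑ a, p a * Real.log (p a)

section JointType

variable {X Y : Type*} [Fintype X] [DecidableEq X] [Fintype Y] [DecidableEq Y] {n : ℕ}

/-- Pairs of words with the same joint type differ by a coordinate permutation. -/
lemma exists_perm_of_jointType_eq {x x' : Fin n → X} {y y' : Fin n → Y}
    (h : jointType x y = jointType x' y') :
    ∃ t : Equiv.Perm (Fin n), x ∘ t = x' ∧ y ∘ t = y' := by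
  have hcard (c : X × Y) : Nonempty ({j // (x' j, y' j) = c} ≃ {j // (x j, y j) = c}) := by
    rw [← Fintype.card_eq, Fintype.card_subtype, Fintype.card_subtype]
    rcases Nat.eq_zero_or_pos n with rfl | hn
    · simp
    · have hc := congrFun h c
      simp only [jointType] at hc
      rw [div_left_inj' (by positivity), Nat.cast_inj] at hc
      simpa [Prod.ext_iff] using hc.symm
  have e := fun c => (hcard c).some
  have ht (j : Fin n) := Equiv.ofFiberEquiv_map (f := fun j => (x' j, y' j))
    (g := fun j => (x j, y j)) e j
  simp only [Prod.mk.injEq] at ht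
  exact ⟨Equiv.ofFiberEquiv e, funext fun j => (ht j).1, funext fun j => (ht j).2⟩

lemma jointType_comp_perm (x : Fin n → X) (y : Fin n → Y) (t : Equiv.Perm (Fin n)) :
    jointType (x ∘ t) (y ∘ t) = jointType x y := by
  ext c
  unfold jointType
  congr 2
  exact Finset.card_equiv t (by simp)

lemma eq_of_jointType_eq_self {x y : Fin n → X} (h : jointType x y = jointType x x) : x = y := by
  obtain ⟨t, ht, ht'⟩ := exists_perm_of_jointType_eq h.symm
  exact ht.symm.trans ht'

/-- The stabilizer of `x` moves `y` to each word of its conditional type class equally often. -/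
lemma ncard_stabilizer_mem_eq_mul (x : Fin n → X) (y : Fin n → Y) (D : Set (Fin n → Y)) :
    {s : Equiv.Perm (Fin n) | x ∘ s.symm = x ∧ y ∘ s.symm ∈ D}.ncard =
      {z | jointType x z = jointType x y ∧ z ∈ D}.ncard *
        {s : Equiv.Perm (Fin n) | x ∘ s.symm = x ∧ y ∘ s.symm = y}.ncard := by
  classical
  simp only [Set.ncard_eq_toFinset_card']
  rw [Finset.card_eq_sum_card_fiberwise (f := fun s : Equiv.Perm (Fin n) => y ∘ s.symm)
    (t := {z | jointType x z = jointType x y ∧ z ∈ D}.toFinset)]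
  · apply Finset.sum_const_nat
    intro z hz
    simp only [Set.mem_toFinset, Set.mem_ofPred_eq] at hz
    obtain ⟨t, hx, hy⟩ := exists_perm_of_jointType_eq hz.1
    have hx' : x ∘ t.symm = x := by
      rw [Equiv.comp_symm_eq, hx]
    have hy' : y ∘ t.symm = z := by
      rw [Equiv.comp_symm_eq, hy]
    refine Finset.card_equiv (Equiv.mulLeft t⁻¹) fun s => ?_
    have hsx : x ∘ (t⁻¹ * s).symm = x ↔ x ∘ s.symm = x :=
      (Equiv.eq_comp_symm t (x ∘ s.symm) x).symm.trans (by rw [hx'])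
    have hsy : y ∘ (t⁻¹ * s).symm = y ↔ y ∘ s.symm = z :=
      (Equiv.eq_comp_symm t (y ∘ s.symm) y).symm.trans (by rw [hy'])
    simp only [Finset.mem_filter, Set.mem_toFinset, Set.mem_ofPred_eq, Equiv.coe_mulLeft, hsx,
      hsy]
    constructor
    · rintro ⟨⟨h, -⟩, h'⟩
      exact ⟨h, h'⟩
    · rintro ⟨h, h'⟩
      exact ⟨⟨h, h' ▸ hz.2⟩, h'⟩
  · intro s hs
    simp only [Set.coe_toFinset, Set.mem_ofPred_eq] at hs ⊢
    refine ⟨?_, hs.2⟩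
    simpa only [hs.1] using jointType_comp_perm x y s.symm

end JointType

/-- If a codebook `C ⊆ T_p` of size `M ≥ e^{nR - √n}` has the packing property for every
non-identical conditional type (any conditional type is represented by a realizing word
`y₀`; the identical one is the joint type of `(x,x)`), then for all distinct `x, x' ∈ C`,
`(1/(|S_x| M)) |{s ∈ S_x : s·x' ∈ C}| ≤ e^{-nH(p)} e^{√n}`, where `S_x` is the stabilizer
of `x` under the coordinate permutation action `(s·x)_j = x_{s⁻¹ j}`. -/
theorem stabilizer_average_bound (k n : ℕ) (hk : 0 < k) (p : Fin k → ℝ)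
    (R : ℝ) (hR : 0 < R)
    (C : Finset (Fin n → Fin k)) (hC : ∀ x ∈ C, typeOf x = p)
    (hpack : ∀ x ∈ C, ∀ y₀ : Fin n → Fin k,
      jointType x y₀ ≠ jointType x x →
      (Set.ncard {y : Fin n → Fin k |
          jointType x y = jointType x y₀ ∧ y ∈ C ∧ y ≠ x} : ℝ) ≤
        (Set.ncard {y : Fin n → Fin k | jointType x y = jointType x y₀} : ℝ) *
          Real.exp (-(n * (shannonH p - R))))
    (hM : Real.exp (n * R - Real.sqrt n) ≤ C.card) :
    ∀ x ∈ C, ∀ x' ∈ C, x ≠ x' →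
      (Set.ncard {s : Equiv.Perm (Fin n) | x ∘ s.symm = x ∧ (x' ∘ s.symm) ∈ C} : ℝ) /
          ((Set.ncard {s : Equiv.Perm (Fin n) | x ∘ s.symm = x} : ℝ) * C.card) ≤
        Real.exp (-(n * shannonH p)) * Real.exp (Real.sqrt n) := by
  intro x hx x' hx' hne
  have hpacked := hpack x hx x' fun h => hne (eq_of_jointType_eq_self h)
  have hset : {y | jointType x y = jointType x x' ∧ y ∈ C ∧ y ≠ x} =
      {y | jointType x y = jointType x x' ∧ y ∈ (C : Set (Fin n → Fin k))} := by
    ext y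
    simp only [Set.mem_ofPred_eq, Finset.mem_coe]
    refine ⟨fun h => ⟨h.1, h.2.1⟩, fun h => ⟨h.1, h.2, ?_⟩⟩
    rintro rfl
    exact hne (eq_of_jointType_eq_self h.1.symm)
  rw [hset] at hpacked
  have hB := ncard_stabilizer_mem_eq_mul x x' (C : Set (Fin n → Fin k))
  have hA := ncard_stabilizer_mem_eq_mul x x' Set.univ
  simp only [Set.mem_univ, and_true, Finset.mem_coe] at hA hB hpacked
  have hS : 0 < {s : Equiv.Perm (Fin n) | x ∘ s.symm = x}.ncard :=
    (Set.ncard_pos (Set.toFinite _)).2 ⟨1, rfl⟩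
  have hratio : ({s : Equiv.Perm (Fin n) | x ∘ s.symm = x ∧ x' ∘ s.symm ∈ C}.ncard : ℝ) ≤
      {s : Equiv.Perm (Fin n) | x ∘ s.symm = x}.ncard *
        Real.exp (-(n * (shannonH p - R))) := by
    rw [hA, hB, Nat.cast_mul, Nat.cast_mul, mul_right_comm]
    gcongr
  have hexp : Real.exp (-(n * (shannonH p - R))) =
      Real.exp (-(n * shannonH p)) * Real.exp (Real.sqrt n) * Real.exp (n * R - Real.sqrt n) := by
    rw [← Real.exp_add, ← Real.exp_add]
    ring_nf
  have hCpos : (0 : ℝ) < C.card := (Real.exp_pos _).trans_le hM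
  rw [div_le_iff₀ (by positivity)]
  calc _ ≤ _ := hratio
    _ ≤ {s : Equiv.Perm (Fin n) | x ∘ s.symm = x}.ncard *
        (Real.exp (-(n * shannonH p)) * Real.exp (Real.sqrt n) * C.card) := by
      rw [hexp]
      gcongr
    _ = _ := by ring
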